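/- arXiv:2506.17607 — 9 statements merged into one kernel-verified Lean document; each statement's English description precedes it below -/
import Mathlib

section
/- Let A, B, C, D be nonnegative real numbers. If A − C ≤ B·√(A + C) + D, then A − C ≤ (3/2)·D + (3/2)·B² + √2·B·√C. -/
/-- Let A, B, C, D be nonnegative real numbers. If A − C ≤ B·√(A + C) + D, then
A − C ≤ (3/2)·D + (3/2)·B² + √2·B·√C. -/
theorem stmt1 (A B C D : ℝ) (hA : 0 ≤ A) (hB : 0 ≤ B) (hC : 0 ≤ C) (hD : 0 ≤ D)
    (h : A - C ≤ B * Real.sqrt (A + C) + D) :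
    A - C ≤ 3 / 2 * D + 3 / 2 * B ^ 2 + Real.sqrt 2 * B * Real.sqrt C := by
  by_contra! hlt
  have hs : Real.sqrt (A + C) ^ 2 = A + C := Real.sq_sqrt (by linarith)
  have hr : Real.sqrt C ^ 2 = C := Real.sq_sqrt hC
  have hq : Real.sqrt 2 ^ 2 = 2 := Real.sq_sqrt (by norm_num)
  have hE : 0 ≤ Real.sqrt 2 * B * Real.sqrt C := by positivity
  have hE2 : (Real.sqrt 2 * B * Real.sqrt C) ^ 2 = 2 * B ^ 2 * C := by
    rw [mul_pow, mul_pow, hq, hr]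
  generalize Real.sqrt 2 * B * Real.sqrt C = E at *
  have hB2 : 0 ≤ B ^ 2 := sq_nonneg B
  have hsq : (A - C - D) ^ 2 ≤ B ^ 2 * (A + C) := by
    rw [← hs, ← mul_pow]
    exact pow_le_pow_left₀ (by linarith) (by linarith) 2
  have hT : (D / 2 + B ^ 2 + E) ^ 2 < (A - C - D - B ^ 2 / 2) ^ 2 :=
    pow_lt_pow_left₀ (by linarith) (by positivity) two_ne_zero
  have hDE : 0 ≤ (D / 2 + B ^ 2) * E := by positivity
  nlinarith [sq_nonneg D, sq_nonneg (B ^ 2)]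
end

section
/- Let ε, ν be real numbers with 0 < 8ε ≤ ν ≤ 1/2, and set p = (ν − 4ε)/(2 − ν) and q = (ν + 4ε)/(2 − ν). Then: (a) for every x ∈ [p, q], x(1 − x) ≥ ν/8; and (b) D_KL(Bern(p)‖Bern(q)) ≤ 64·ε²/ν. -/
/-- The Kullback–Leibler divergence of two Bernoulli distributions is at most their
chi-square divergence. -/
theorem bernoulli_kl_le_chiSq {p q : ℝ} (hp0 : 0 < p) (hp1 : p < 1) (hq0 : 0 < q) (hq1 : q < 1) :
    p * Real.log (p / q) + (1 - p) * Real.log ((1 - p) / (1 - q))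
      ≤ (q - p) ^ 2 / (q * (1 - q)) := by
  have hp : 0 < 1 - p := sub_pos.2 hp1
  have hq : 0 < 1 - q := sub_pos.2 hq1
  calc p * Real.log (p / q) + (1 - p) * Real.log ((1 - p) / (1 - q))
      ≤ p * (p / q - 1) + (1 - p) * ((1 - p) / (1 - q) - 1) := by
        gcongr
        · exact Real.log_le_sub_one_of_pos (by positivity)
        · exact Real.log_le_sub_one_of_pos (by positivity)
    _ = (q - p) ^ 2 / (q * (1 - q)) := by
        field_simp
        ring


/-- Let ε, ν be real numbers with 0 < 8ε ≤ ν ≤ 1/2, and set p = (ν − 4ε)/(2 − ν)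
and q = (ν + 4ε)/(2 − ν). Then:
(a) for every x ∈ [p, q], x(1 − x) ≥ ν/8; and
(b) D_KL(Bern(p)‖Bern(q)) = p·ln(p/q) + (1−p)·ln((1−p)/(1−q)) ≤ 64·ε²/ν. -/
theorem stmt3 (ε ν : ℝ) (hε : 0 < 8 * ε) (h1 : 8 * ε ≤ ν) (h2 : ν ≤ 1 / 2) :
    (∀ x ∈ Set.Icc ((ν - 4 * ε) / (2 - ν)) ((ν + 4 * ε) / (2 - ν)),
        ν / 8 ≤ x * (1 - x)) ∧
    ((ν - 4 * ε) / (2 - ν)) *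
        Real.log (((ν - 4 * ε) / (2 - ν)) / ((ν + 4 * ε) / (2 - ν)))
      + (1 - (ν - 4 * ε) / (2 - ν)) *
        Real.log ((1 - (ν - 4 * ε) / (2 - ν)) / (1 - (ν + 4 * ε) / (2 - ν)))
      ≤ 64 * ε ^ 2 / ν := by
  have hd : 0 < 2 - ν := by linarith
  have hp : ν / 4 ≤ (ν - 4 * ε) / (2 - ν) := by
    rw [le_div_iff₀ hd]
    nlinarith
  have hq : (ν + 4 * ε) / (2 - ν) ≤ 1 / 2 := by
    rw [div_le_iff₀ hd]
    linarith
  have hpq : (ν - 4 * ε) / (2 - ν) < (ν + 4 * ε) / (2 - ν) := by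
    gcongr
    linarith
  constructor
  · rintro x ⟨hpx, hxq⟩
    nlinarith
  · refine (bernoulli_kl_le_chiSq (by linarith) (by linarith) (by linarith)
      (by linarith)).trans ?_
    have hν : 0 < ν := by linarith
    have hvar : ν ≤ (ν + 4 * ε) * (2 - 2 * ν - 4 * ε) := by
      nlinarith [mul_nonneg hν.le (by linarith : 0 ≤ 1 - 2 * ν),
        mul_nonneg (by linarith : 0 ≤ 4 * ε) (by linarith : 0 ≤ 2 - 3 * ν - 4 * ε)]
    have hchi : ((ν + 4 * ε) / (2 - ν) - (ν - 4 * ε) / (2 - ν)) ^ 2 /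
        ((ν + 4 * ε) / (2 - ν) * (1 - (ν + 4 * ε) / (2 - ν))) =
        64 * ε ^ 2 / ((ν + 4 * ε) * (2 - 2 * ν - 4 * ε)) := by
      have hnum : (ν + 4 * ε) / (2 - ν) - (ν - 4 * ε) / (2 - ν) = 8 * ε / (2 - ν) := by
        ring
      have hden : 1 - (ν + 4 * ε) / (2 - ν) = (2 - 2 * ν - 4 * ε) / (2 - ν) := by
        rw [eq_div_iff hd.ne', sub_mul, div_mul_cancel₀ _ hd.ne']
        ring
      rw [hnum, hden, div_mul_div_comm, div_pow, ← sq,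
        div_div_div_cancel_right₀ (pow_ne_zero 2 hd.ne')]
      ring
    rw [hchi]
    gcongr
end

section
/- For every integer k ≥ 1 and every real ε ∈ (0,1), there exist a finite set X, a hypothesis class H of functions X → {−1,+1} containing a hypothesis h*, and probability distributions D₁, …, D_k over X × {−1,+1}, such that, letting D̄ = (1/k)·Σ_{i=1}^k D_i denote the average distribution, θ_{D̄,H,h*}(ε/k) ≥ k · max_{i∈[k]} θ_{D_i,H,h*}(ε). -/
/-!
Labels live in {−1, +1}, which we encode as `Bool` with `false ↦ −1` and
`true ↦ +1`.  A distribution over `X × Bool` (for a finite type `X`) is a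
nonnegative function summing to 1.  Below we set up the X-marginal, the
disagreement pseudometric ρ, disagreement balls, disagreement regions,
and the disagreement coefficient θ, exactly as in the paper.
-/

/-- The X-marginal mass of a distribution `D` on `X × {−1,+1}` at a point `x`. -/
noncomputable def marginalMass {X : Type*} (D : X × Bool → ℝ) (x : X) : ℝ :=
  D (x, false) + D (x, true)

open Classical in
/-- `P_{x ∼ D_X}[x ∈ S]`, the probability of a set `S ⊆ X` under the X-marginal. -/
noncomputable def probX {X : Type*} [Fintype X] (D : X × Bool → ℝ) (S : Set X) : ℝ :=
  ∑ x : X, if x ∈ S then marginalMass D x else 0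

/-- The disagreement pseudometric `ρ_D(h, h') = P_{x ∼ D_X}[h(x) ≠ h'(x)]`. -/
noncomputable def rho {X : Type*} [Fintype X] (D : X × Bool → ℝ)
    (h h' : X → Bool) : ℝ :=
  probX D {x | h x ≠ h' x}

/-- The disagreement ball `B_D(h*, r) = {h ∈ H : ρ_D(h, h*) ≤ r}`. -/
def ball {X : Type*} [Fintype X] (D : X × Bool → ℝ) (H : Set (X → Bool))
    (hstar : X → Bool) (r : ℝ) : Set (X → Bool) :=
  {h | h ∈ H ∧ rho D h hstar ≤ r}

/-- The disagreement region `DIS(V) = {x : ∃ h₁, h₂ ∈ V, h₁(x) ≠ h₂(x)}`. -/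
def DIS {X : Type*} (V : Set (X → Bool)) : Set X :=
  {x | ∃ h₁ ∈ V, ∃ h₂ ∈ V, h₁ x ≠ h₂ x}

/-- The disagreement coefficient
`θ_{D,H,h*}(r₀) = sup_{r ≥ r₀} P_{x∼D_X}[x ∈ DIS(B_D(h*, r))] / r`. -/
noncomputable def theta {X : Type*} [Fintype X] (D : X × Bool → ℝ)
    (H : Set (X → Bool)) (hstar : X → Bool) (r0 : ℝ) : ℝ :=
  ⨆ r : {r : ℝ // r0 ≤ r}, probX D (DIS (ball D H hstar r.1)) / r.1

/-- `D` is a probability distribution on `X × {−1,+1}`. -/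
def IsDistrib {X : Type*} [Fintype X] (D : X × Bool → ℝ) : Prop :=
  (∀ p, 0 ≤ D p) ∧ ∑ p, D p = 1

/-- The distribution with mass `ε` at `(i.succ, -1)` and mass `1 - ε` at `(0, -1)`. -/
noncomputable def spike {k : ℕ} (ε : ℝ) (i : Fin k) (p : Fin (k + 1) × Bool) : ℝ :=
  if p.2 then 0 else Fin.cases (1 - ε) (fun j => if j = i then ε else 0) p.1

/-- The constant `-1` hypothesis together with the indicators of the points `j.succ`. -/
def singletonClass (k : ℕ) : Set (Fin (k + 1) → Bool) :=
  insert (fun _ => false) (Set.range fun (j : Fin k) x => decide (x = j.succ))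

lemma isDistrib_spike {k : ℕ} {ε : ℝ} (h0 : 0 ≤ ε) (h1 : ε ≤ 1) (i : Fin k) :
    IsDistrib (spike ε i) := by
  constructor
  · rintro ⟨x, b⟩
    cases b
    · refine Fin.cases ?_ (fun j => ?_) x
      · simpa [spike] using h1
      · by_cases h : j = i <;> simp [spike, h, h0]
    · simp [spike]
  · simp [Fintype.sum_prod_type, Fin.sum_univ_succ, spike]

lemma IsDistrib.average {X : Type*} [Fintype X] {k : ℕ} (hk : k ≠ 0)
    {D : Fin k → X × Bool → ℝ} (hD : ∀ i, IsDistrib (D i)) :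
    IsDistrib (fun p => (1 / (k : ℝ)) * ∑ i, D i p) := by
  refine ⟨fun p => mul_nonneg (by positivity) (Finset.sum_nonneg fun i _ => (hD i).1 p), ?_⟩
  rw [← Finset.mul_sum, Finset.sum_comm]
  simp [(hD _).2, hk]

lemma probX_mono {X : Type*} [Fintype X] {D : X × Bool → ℝ} (hD : ∀ p, 0 ≤ D p)
    {S T : Set X} (h : S ⊆ T) : probX D S ≤ probX D T := by
  refine Finset.sum_le_sum fun x _ => ?_
  have hx : 0 ≤ marginalMass D x := add_nonneg (hD _) (hD _)
  by_cases hS : x ∈ S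
  · simp [hS, h hS]
  · by_cases hT : x ∈ T <;> simp [hS, hT, hx]

lemma probX_le_one {X : Type*} [Fintype X] {D : X × Bool → ℝ} (hD : IsDistrib D)
    (S : Set X) : probX D S ≤ 1 := by
  refine (probX_mono hD.1 (Set.subset_univ S)).trans_eq ?_
  rw [← hD.2, Fintype.sum_prod_type]
  simp [probX, marginalMass, add_comm]

lemma div_le_theta {X : Type*} [Fintype X] {D : X × Bool → ℝ} (hD : IsDistrib D)
    (H : Set (X → Bool)) (hstar : X → Bool) {r : ℝ} (hr : 0 < r) :
    probX D (DIS (ball D H hstar r)) / r ≤ theta D H hstar r := by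
  refine le_ciSup (f := fun s : {s : ℝ // r ≤ s} =>
    probX D (DIS (ball D H hstar s.1)) / s.1) ⟨1 / r, ?_⟩ ⟨r, le_rfl⟩
  rintro _ ⟨⟨s, hs⟩, rfl⟩
  exact div_le_div₀ zero_le_one (probX_le_one hD _) hr hs

lemma DIS_subset_of_subset_singletonClass {k : ℕ} {V : Set (Fin (k + 1) → Bool)}
    (hV : V ⊆ singletonClass k) : DIS V ⊆ {x | x ≠ 0} := by
  have hzero : ∀ h ∈ V, h 0 = false := by
    intro h hh
    rcases hV hh with rfl | ⟨j, rfl⟩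
    · rfl
    · simp [(Fin.succ_ne_zero j).symm]
  rintro x ⟨h₁, hh₁, h₂, hh₂, hne⟩ rfl
  exact hne ((hzero h₁ hh₁).trans (hzero h₂ hh₂).symm)

lemma theta_spike_le_one {k : ℕ} {ε : ℝ} (h0 : 0 < ε) (h1 : ε ≤ 1) (i : Fin k) :
    theta (spike ε i) (singletonClass k) (fun _ => false) ε ≤ 1 := by
  have : Nonempty {r : ℝ // ε ≤ r} := ⟨⟨ε, le_rfl⟩⟩
  refine ciSup_le fun ⟨r, hr⟩ => ?_
  rw [div_le_one (h0.trans_le hr)]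
  refine (probX_mono (isDistrib_spike h0.le h1 i).1
    (DIS_subset_of_subset_singletonClass fun _ h => h.1)).trans (le_trans ?_ hr)
  simp [probX, marginalMass, spike, Fin.sum_univ_succ]

lemma marginalMass_average_spike_succ {k : ℕ} (ε : ℝ) (j : Fin k) :
    marginalMass (fun p => (1 / (k : ℝ)) * ∑ i, spike ε i p) j.succ = ε / k := by
  simp [marginalMass, spike, div_eq_inv_mul]

lemma le_theta_average_spike {k : ℕ} (hk : k ≠ 0) {ε : ℝ} (h0 : 0 < ε) (h1 : ε ≤ 1) :
    (k : ℝ) ≤ theta (fun p => (1 / (k : ℝ)) * ∑ i : Fin k, spike ε i p) (singletonClass k)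
      (fun _ => false) (ε / k) := by
  have hk' : (0 : ℝ) < k := by positivity
  have hD := IsDistrib.average hk fun i : Fin k => isDistrib_spike h0.le h1 i
  refine le_trans ?_ (div_le_theta hD (singletonClass k) (fun _ => false) (div_pos h0 hk'))
  set D := fun p => (1 / (k : ℝ)) * ∑ i : Fin k, spike ε i p
  have hmass (j : Fin k) : marginalMass D j.succ = ε / k := marginalMass_average_spike_succ ε j
  have hsub : {x | x ≠ 0} ⊆ DIS (ball D (singletonClass k) (fun _ => false) (ε / k)) := by
    intro x hx
    obtain ⟨j, rfl⟩ := Fin.exists_succ_eq.2 hx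
    refine ⟨fun x => decide (x = j.succ), ⟨Or.inr ⟨j, rfl⟩, ?_⟩,
      fun _ => false, ⟨Or.inl rfl, ?_⟩, by simp⟩
    · simp [rho, probX, hmass]
    · simpa [rho, probX] using (div_pos h0 hk').le
  have hprob : probX D {x | x ≠ 0} = ε := by
    simp [probX, Fin.sum_univ_succ, hmass]
    field_simp
  rw [le_div_iff₀ (div_pos h0 hk'), mul_div_cancel₀ _ hk'.ne']
  exact hprob.ge.trans (probX_mono hD.1 hsub)

/-- For every integer k ≥ 1 and every real ε ∈ (0,1), there exist a finite set X
(taken here as `Fin n`), a hypothesis class H of functions X → {−1,+1} containing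
a hypothesis h*, and probability distributions D₁, …, D_k over X × {−1,+1},
such that, letting D̄ = (1/k)·Σᵢ Dᵢ denote the average distribution,
θ_{D̄,H,h*}(ε/k) ≥ k · maxᵢ θ_{Dᵢ,H,h*}(ε). -/
theorem stmt4 (k : ℕ) (hk : 1 ≤ k) (ε : ℝ) (hε : 0 < ε) (hε1 : ε < 1) :
    ∃ (n : ℕ) (H : Set (Fin n → Bool)) (hstar : Fin n → Bool)
      (D : Fin k → (Fin n × Bool → ℝ)),
      hstar ∈ H ∧ (∀ i, IsDistrib (D i)) ∧
      (k : ℝ) * (⨆ i : Fin k, theta (D i) H hstar ε) ≤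
        theta (fun p => (1 / (k : ℝ)) * ∑ i, D i p) H hstar (ε / k) := by
  have hk0 : k ≠ 0 := Nat.one_le_iff_ne_zero.1 hk
  have : Nonempty (Fin k) := ⟨⟨0, hk⟩⟩
  refine ⟨k + 1, singletonClass k, fun _ => false, spike ε, Or.inl rfl,
    isDistrib_spike hε.le hε1.le, le_trans ?_ (le_theta_average_spike hk0 hε hε1.le)⟩
  exact mul_le_of_le_one_right k.cast_nonneg
    (ciSup_le fun i => theta_spike_le_one hε hε1.le i)
end

section
/- Fix an integer k ≥ 1 and a real ε ∈ (0,1). Let X = {x₀, x₁, …, x_k} be a set of k+1 distinct points, let h* : X → {−1,+1} be the constant −1 function, and for each i ∈ [k] let hᵢ : X → {−1,+1} satisfy hᵢ(x_i) = +1 and hᵢ(x_j) = −1 for all j ≠ i; set H = {h*, h₁, …, h_k}. For each i ∈ [k], let Dᵢ be the distribution on X × {−1,+1} that puts mass 1−ε on (x₀, −1) and mass ε on (x_i, +1), and let D̄ = (1/k)·Σ_{i=1}^k Dᵢ. Then θ_{Dᵢ,H,h*}(ε) = 1 for every i ∈ [k], and θ_{D̄,H,h*}(ε/k) = k. -/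
/-- If every hypothesis lies within `r₀` of `h*`, every ball of radius `r ≥ r₀` is all of `H`, so
the supremum defining the disagreement coefficient is attained at `r₀`. -/
theorem theta_eq_of_forall_rho_le {X : Type*} [Fintype X] {D : X × Bool → ℝ}
    {H : Set (X → Bool)} {hstar : X → Bool} {r0 : ℝ} (hr0 : 0 < r0)
    (hH : ∀ g ∈ H, rho D g hstar ≤ r0) (hD : 0 ≤ probX D (DIS H)) :
    theta D H hstar r0 = probX D (DIS H) / r0 := by
  have hball : ∀ r, r0 ≤ r → ball D H hstar r = H := fun r hr =>
    Set.ext fun g => ⟨fun hg => hg.1, fun hg => ⟨hg, (hH g hg).trans hr⟩⟩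
  have hle : ∀ r : {r : ℝ // r0 ≤ r},
      probX D (DIS (ball D H hstar r.1)) / r.1 ≤ probX D (DIS H) / r0 := by
    rintro ⟨r, hr⟩
    rw [hball r hr]
    exact div_le_div_of_nonneg_left hD hr0 hr
  have : Nonempty {r : ℝ // r0 ≤ r} := ⟨⟨r0, le_rfl⟩⟩
  refine le_antisymm (ciSup_le hle) ?_
  have h := le_ciSup (f := fun r : {r : ℝ // r0 ≤ r} =>
    probX D (DIS (ball D H hstar r.1)) / r.1) ⟨_, Set.forall_mem_range.2 hle⟩ ⟨r0, le_rfl⟩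
  simpa only [theta, hball r0 le_rfl] using h

theorem probX_empty {X : Type*} [Fintype X] (D : X × Bool → ℝ) : probX D ∅ = 0 := by
  simp [probX]

theorem probX_singleton {X : Type*} [Fintype X] (D : X × Bool → ℝ) (x : X) :
    probX D {x} = marginalMass D x := by
  classical
  simp [probX]

theorem probX_ne_zero {k : ℕ} (D : Fin (k + 1) × Bool → ℝ) :
    probX D {x | x ≠ 0} = ∑ j : Fin k, marginalMass D j.succ := by
  simp [probX, Fin.sum_univ_succ]

/-- The disagreement region of the constant `-1` function and the indicators of `x₁, …, x_k`. -/
theorem DIS_insert_range_indicator (k : ℕ) :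
    DIS (insert (fun _ => false)
      (Set.range fun (i : Fin k) (j : Fin (k + 1)) => decide (j = i.succ))) = {x | x ≠ 0} := by
  ext x
  constructor
  · rintro ⟨g₁, hg₁, g₂, hg₂, hne⟩ rfl
    have key : ∀ g ∈ insert (fun _ => false)
        (Set.range fun (i : Fin k) (j : Fin (k + 1)) => decide (j = i.succ)),
        g 0 = false := by
      rintro g (rfl | ⟨i, rfl⟩)
      · rfl
      · simpa using (Fin.succ_ne_zero i).symm
    exact hne ((key g₁ hg₁).trans (key g₂ hg₂).symm)
  · intro hx
    obtain ⟨i, rfl⟩ := Fin.exists_succ_eq.2 hx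
    exact ⟨_, Or.inr ⟨i, rfl⟩, _, Or.inl rfl, by simp⟩

/-- The disagreement coefficient of the indicator class when no point `x₁, …, x_k` has mass
above `r₀`. -/
theorem theta_insert_range_indicator {k : ℕ} {D : Fin (k + 1) × Bool → ℝ} {r0 : ℝ} (hr0 : 0 < r0)
    (h0 : ∀ j : Fin k, 0 ≤ marginalMass D j.succ) (hle : ∀ j : Fin k, marginalMass D j.succ ≤ r0) :
    theta D (insert (fun _ => false)
      (Set.range fun (i : Fin k) (j : Fin (k + 1)) => decide (j = i.succ))) (fun _ => false) r0 =
      (∑ j : Fin k, marginalMass D j.succ) / r0 := by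
  rw [theta_eq_of_forall_rho_le hr0, DIS_insert_range_indicator, probX_ne_zero]
  · rintro g (rfl | ⟨i, rfl⟩)
    · simpa [rho, probX_empty] using hr0.le
    · simpa [rho, probX_singleton] using hle i
  · rw [DIS_insert_range_indicator, probX_ne_zero]
    exact Finset.sum_nonneg fun j _ => h0 j

/-- Fix k ≥ 1 and ε ∈ (0,1).  On X = {x₀, …, x_k} (encoded as `Fin (k+1)`),
let h* ≡ −1 (i.e. `false`), and for i ∈ [k] let hᵢ(x) = +1 iff x = xᵢ; set
H = {h*, h₁, …, h_k}.  Let Dᵢ put mass 1−ε on (x₀, −1) and mass ε on (xᵢ, +1),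
and let D̄ = (1/k)·Σᵢ Dᵢ.  Then θ_{Dᵢ,H,h*}(ε) = 1 for every i, and
θ_{D̄,H,h*}(ε/k) = k. -/
theorem stmt5 (k : ℕ) (hk : 1 ≤ k) (ε : ℝ) (hε : 0 < ε) (hε1 : ε < 1) :
    let hstar : Fin (k + 1) → Bool := fun _ => false
    let h : Fin k → Fin (k + 1) → Bool := fun i j => decide (j = i.succ)
    let H : Set (Fin (k + 1) → Bool) := insert hstar (Set.range h)
    let D : Fin k → (Fin (k + 1) × Bool → ℝ) := fun i p =>
      if p = ((0 : Fin (k + 1)), false) then 1 - ε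
      else if p = (i.succ, true) then ε else 0
    let Dbar : Fin (k + 1) × Bool → ℝ := fun p => (1 / (k : ℝ)) * ∑ i, D i p
    (∀ i : Fin k, theta (D i) H hstar ε = 1) ∧
      theta Dbar H hstar (ε / k) = k := by
  intro hstar h H D Dbar
  have hk0 : (0 : ℝ) < k := by exact_mod_cast hk
  have hD : ∀ i j : Fin k, marginalMass (D i) j.succ = if j = i then ε else 0 := fun i j => by
    simp [marginalMass, D]
  have hDbar : ∀ j : Fin k, marginalMass Dbar j.succ = ε / k := fun j => by
    have : marginalMass Dbar j.succ = 1 / (k : ℝ) * ∑ i, marginalMass (D i) j.succ := by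
      simp only [marginalMass, Dbar, Finset.sum_add_distrib, mul_add]
    rw [this]
    simp only [hD, Finset.sum_ite_eq, Finset.mem_univ, if_true]
    ring
  constructor
  · intro i
    refine (theta_insert_range_indicator hε (fun j => ?_) (fun j => ?_)).trans ?_
    · rw [hD]; split_ifs <;> linarith
    · rw [hD]; split_ifs <;> linarith
    · simp [hD, hε.ne']
  · refine (theta_insert_range_indicator (div_pos hε hk0) (fun j => ?_) (fun j => ?_)).trans ?_
    · rw [hDbar]; positivity
    · rw [hDbar]
    · simp only [hDbar, Finset.sum_const, Finset.card_univ, Fintype.card_fin, nsmul_eq_mul]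
      field_simp
end

section
/- With the Hedge iterates, the cumulative weighted payoff satisfies the regret inequality Σ_{t=1}^T ⟨w^t, r̂^t⟩ ≥ max_{1≤i≤k} Σ_{t=1}^T r̂_i^t − ln(k)/η − η·Σ_{t=1}^T ⟨w^t, r̂^t⟩. -/
/-- If `0 ≤ η ≤ 1` and `0 ≤ x ≤ 1`, the exponential of `η * x` is at most `1 + (η + η ^ 2) * x`. -/
theorem exp_mul_le_one_add_mul {η x : ℝ} (hη0 : 0 ≤ η) (hη1 : η ≤ 1) (hx0 : 0 ≤ x) (hx1 : x ≤ 1) :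
    Real.exp (η * x) ≤ 1 + (η + η ^ 2) * x := by
  have hle : |η * x| ≤ 1 := by
    rw [abs_of_nonneg (mul_nonneg hη0 hx0)]
    exact mul_le_one₀ hη1 hx0 hx1
  have hexp := (abs_le.mp (Real.abs_exp_sub_one_sub_id_le hle)).2
  have hsq : η ^ 2 * x ^ 2 ≤ η ^ 2 * x :=
    mul_le_mul_of_nonneg_left (by nlinarith) (sq_nonneg η)
  nlinarith

/-- One multiplicative-weights update increases the total weight by a factor at most
`exp ((η + η ^ 2) * p)`, where `p` is the payoff of the normalized weights. -/
theorem sum_mul_exp_le {ι : Type*} [Fintype ι] {η : ℝ} (hη0 : 0 ≤ η) (hη1 : η ≤ 1)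
    {v x : ι → ℝ} (hv : ∀ i, 0 ≤ v i) (hpos : 0 < ∑ i, v i)
    (hx : ∀ i, 0 ≤ x i ∧ x i ≤ 1) :
    ∑ i, v i * Real.exp (η * x i) ≤
      (∑ i, v i) * Real.exp ((η + η ^ 2) * ∑ i, v i / (∑ j, v j) * x i) := by
  have hmean : (∑ i, v i) * ∑ i, v i / (∑ j, v j) * x i = ∑ i, v i * x i := by
    rw [Finset.mul_sum]
    refine Finset.sum_congr rfl fun i _ => ?_
    field_simp
  calc ∑ i, v i * Real.exp (η * x i)
      ≤ ∑ i, v i * (1 + (η + η ^ 2) * x i) :=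
        Finset.sum_le_sum fun i _ => mul_le_mul_of_nonneg_left
          (exp_mul_le_one_add_mul hη0 hη1 (hx i).1 (hx i).2) (hv i)
    _ = ∑ i, v i + (η + η ^ 2) * ∑ i, v i * x i := by
        rw [Finset.mul_sum, ← Finset.sum_add_distrib]
        exact Finset.sum_congr rfl fun i _ => by ring
    _ = (∑ i, v i) * ((η + η ^ 2) * (∑ i, v i / (∑ j, v j) * x i) + 1) := by
        rw [← hmean]
        ring
    _ ≤ _ := mul_le_mul_of_nonneg_left (Real.add_one_le_exp _) hpos.le

/-- Hedge regret inequality.  Given k ≥ 1, T ≥ 1, a step size η ∈ (0,1], and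
payoff vectors r̂¹, …, r̂ᵀ ∈ [0,1]^k, the Hedge iterates are Wᵢ¹ = 1 and
Wᵢ^{t+1} = Wᵢᵗ·exp(η·r̂ᵢᵗ), with Zᵗ = Σᵢ Wᵢᵗ and wᵢᵗ = Wᵢᵗ/Zᵗ.  (Here time is
0-indexed: `W t`, `w t`, `Z t` are the quantities at round t+1, and `r t` is the
payoff vector of round t+1, for 0 ≤ t < T.)  Then the cumulative weighted payoff
satisfies
Σ_{t=1}^T ⟨wᵗ, r̂ᵗ⟩ ≥ max_{1≤i≤k} Σ_{t=1}^T r̂ᵢᵗ − ln(k)/η − η·Σ_{t=1}^T ⟨wᵗ, r̂ᵗ⟩. -/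
theorem stmt6 (k T : ℕ) (hk : 1 ≤ k) (hT : 1 ≤ T)
    (η : ℝ) (hη0 : 0 < η) (hη1 : η ≤ 1)
    (r : ℕ → Fin k → ℝ) (hr : ∀ t < T, ∀ i, 0 ≤ r t i ∧ r t i ≤ 1)
    (W : ℕ → Fin k → ℝ) (hW0 : ∀ i, W 0 i = 1)
    (hWrec : ∀ t < T, ∀ i, W (t + 1) i = W t i * Real.exp (η * r t i))
    (Z : ℕ → ℝ) (hZ : ∀ t, Z t = ∑ i, W t i)
    (w : ℕ → Fin k → ℝ) (hw : ∀ t i, w t i = W t i / Z t) :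
    (⨆ i : Fin k, ∑ t ∈ Finset.range T, r t i) - Real.log k / η
        - η * ∑ t ∈ Finset.range T, ∑ i, w t i * r t i
      ≤ ∑ t ∈ Finset.range T, ∑ i, w t i * r t i := by
  have : Nonempty (Fin k) := ⟨⟨0, hk⟩⟩
  have hW : ∀ n ≤ T, ∀ i, W n i = Real.exp (η * ∑ t ∈ Finset.range n, r t i) := by
    intro n
    induction n with
    | zero => simp [hW0]
    | succ n ih =>
      intro hn i
      rw [hWrec n hn, ih (Nat.le_of_succ_le hn), Finset.sum_range_succ, mul_add, Real.exp_add]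
  have hWpos : ∀ n ≤ T, ∀ i, 0 < W n i := fun n hn i => by
    rw [hW n hn i]
    exact Real.exp_pos _
  have hZle : ∀ n ≤ T, Z n ≤
      k * Real.exp ((η + η ^ 2) * ∑ t ∈ Finset.range n, ∑ i, w t i * r t i) := by
    intro n
    induction n with
    | zero => simp [hZ, hW0]
    | succ n ih =>
      intro hn
      have hn' := Nat.le_of_succ_le hn
      have hstep := sum_mul_exp_le hη0.le hη1 (fun i => (hWpos n hn' i).le)
        (Finset.sum_pos (fun i _ => hWpos n hn' i) Finset.univ_nonempty) (hr n hn)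
      simp only [← hWrec n hn, ← hZ, ← hw] at hstep
      rw [Finset.sum_range_succ, mul_add, Real.exp_add, ← mul_assoc]
      exact hstep.trans (mul_le_mul_of_nonneg_right (ih hn') (Real.exp_pos _).le)
  rw [sub_le_iff_le_add, sub_le_iff_le_add]
  refine ciSup_le fun i => ?_
  have hWZ : W T i ≤ Z T := by
    rw [hZ]
    exact Finset.single_le_sum (fun j _ => (hWpos T le_rfl j).le) (Finset.mem_univ i)
  have hkpos : (0 : ℝ) < k := Nat.cast_pos.mpr hk
  have hlog := Real.log_le_log (hWpos T le_rfl i) (hWZ.trans (hZle T le_rfl))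
  rw [hW T le_rfl, Real.log_exp, Real.log_mul hkpos.ne' (Real.exp_pos _).ne',
    Real.log_exp] at hlog
  refine le_of_mul_le_mul_left (hlog.trans_eq ?_) hη0
  field_simp
  ring
end

section
/- With the Hedge iterates, for any 1 ≤ t ≤ t₂ ≤ T+1, the Kullback–Leibler divergence between the normalized weight vectors satisfies the exact identity D_KL(w^t ‖ w^{t₂}) = ln(Z^{t₂}/Z^t) − η·Σ_{τ=t}^{t₂−1} ⟨r̂^τ, w^t⟩. -/
/-- Multiplicative updates `W (t + 1) = W t * exp (η * r t)` accumulate to the exponential of the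
total payoff. -/
theorem eq_mul_exp_sum_Ico_of_step {T : ℕ} {η : ℝ} {W r : ℕ → ℝ}
    (h : ∀ t < T, W (t + 1) = W t * Real.exp (η * r t)) {s t : ℕ} (hst : s ≤ t) (htT : t ≤ T) :
    W t = W s * Real.exp (η * ∑ τ ∈ Finset.Ico s t, r τ) := by
  induction t, hst using Nat.le_induction with
  | base => simp
  | succ t hst ih =>
    rw [h t (by omega), ih (by omega), Finset.sum_Ico_succ_top hst, mul_add, Real.exp_add,
      mul_assoc]

/-- Hedge KL identity.  Given k ≥ 1, T ≥ 1, a step size η ∈ (0,1], and payoff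
vectors r̂¹, …, r̂ᵀ ∈ [0,1]^k, the Hedge iterates are Wᵢ¹ = 1 and
Wᵢ^{t+1} = Wᵢᵗ·exp(η·r̂ᵢᵗ), with Zᵗ = Σᵢ Wᵢᵗ and wᵢᵗ = Wᵢᵗ/Zᵗ.  (Here time is
0-indexed: `W t`, `w t`, `Z t` are the quantities at round t+1, so the times
1 ≤ t ≤ t₂ ≤ T+1 of the statement correspond to indices 0 ≤ t ≤ t₂ ≤ T, and
`r t` is the payoff vector of round t+1 for 0 ≤ t < T.)  Then for any
1 ≤ t ≤ t₂ ≤ T+1, with D_KL(u‖v) = Σᵢ uᵢ·ln(uᵢ/vᵢ),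
D_KL(wᵗ ‖ w^{t₂}) = ln(Z^{t₂}/Zᵗ) − η·Σ_{τ=t}^{t₂−1} ⟨r̂^τ, wᵗ⟩. -/
theorem stmt7 (k T : ℕ) (hk : 1 ≤ k) (hT : 1 ≤ T)
    (η : ℝ) (hη0 : 0 < η) (hη1 : η ≤ 1)
    (r : ℕ → Fin k → ℝ) (hr : ∀ t < T, ∀ i, 0 ≤ r t i ∧ r t i ≤ 1)
    (W : ℕ → Fin k → ℝ) (hW0 : ∀ i, W 0 i = 1)
    (hWrec : ∀ t < T, ∀ i, W (t + 1) i = W t i * Real.exp (η * r t i))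
    (Z : ℕ → ℝ) (hZ : ∀ t, Z t = ∑ i, W t i)
    (w : ℕ → Fin k → ℝ) (hw : ∀ t i, w t i = W t i / Z t)
    (t t₂ : ℕ) (htt₂ : t ≤ t₂) (ht₂T : t₂ ≤ T) :
    ∑ i, w t i * Real.log (w t i / w t₂ i)
      = Real.log (Z t₂ / Z t)
        - η * ∑ τ ∈ Finset.Ico t t₂, ∑ i, r τ i * w t i := by
  have hWpos : ∀ s ≤ T, ∀ i, 0 < W s i := fun s hs i => by
    rw [eq_mul_exp_sum_Ico_of_step (W := fun t => W t i) (fun t ht => hWrec t ht i)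
      (Nat.zero_le s) hs, hW0 i]
    positivity
  have hZpos : ∀ s ≤ T, 0 < Z s := fun s hs => by
    rw [hZ]
    exact Finset.sum_pos (fun i _ => hWpos s hs i) ⟨⟨0, hk⟩, Finset.mem_univ _⟩
  have htT := htt₂.trans ht₂T
  have hZt := hZpos t htT
  have hZt₂ := hZpos t₂ ht₂T
  have hw_sum : ∑ i, w t i = 1 := by
    simp_rw [hw, ← Finset.sum_div, ← hZ]
    exact div_self hZt.ne'
  have hlog : ∀ i, Real.log (w t i / w t₂ i)
      = Real.log (Z t₂ / Z t) - η * ∑ τ ∈ Finset.Ico t t₂, r τ i := fun i => by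
    have hWt := hWpos t htT i
    have hWt₂ := eq_mul_exp_sum_Ico_of_step (W := fun t => W t i) (fun t ht => hWrec t ht i)
      htt₂ ht₂T
    have hratio : w t i / w t₂ i
        = Z t₂ / Z t / Real.exp (η * ∑ τ ∈ Finset.Ico t t₂, r τ i) := by
      rw [hw, hw, hWt₂]
      field_simp
    rw [hratio, Real.log_div (div_pos hZt₂ hZt).ne' (Real.exp_pos _).ne', Real.log_exp]
  simp_rw [hlog, mul_sub, Finset.sum_sub_distrib, ← Finset.sum_mul, hw_sum, one_mul]
  rw [Finset.sum_comm, Finset.mul_sum]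
  congr 1
  refine Finset.sum_congr rfl fun i _ => ?_
  rw [← Finset.sum_mul]
  ring
end

section
/- With the Hedge iterates, for any 1 ≤ t ≤ t₂ ≤ T+1, the Kullback–Leibler divergence between the normalized weight vectors satisfies D_KL(w^t ‖ w^{t₂}) ≤ (η + 2η²)·Σ_{τ=t}^{t₂−1} ⟨r̂^τ, w^τ⟩ − η·Σ_{τ=t}^{t₂−1} ⟨r̂^τ, w^t⟩. -/
lemma Real.exp_mul_le_one_add {η r : ℝ} (hη0 : 0 ≤ η) (hη1 : η ≤ 1) (hr0 : 0 ≤ r) (hr1 : r ≤ 1) :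
    Real.exp (η * r) ≤ 1 + (η + 2 * η ^ 2) * r := by
  have h0 : 0 ≤ η * r := mul_nonneg hη0 hr0
  have h1 : |η * r| ≤ 1 := by
    rw [abs_of_nonneg h0]
    exact mul_le_one₀ hη1 hr0 hr1
  have h := (abs_le.mp (Real.abs_exp_sub_one_sub_id_le h1)).2
  have h2 : η ^ 2 * r ^ 2 ≤ η ^ 2 * r := by
    gcongr
    nlinarith
  have h3 : 0 ≤ η ^ 2 * r := by positivity
  nlinarith


/-- Hedge KL upper bound.  Given k ≥ 1, T ≥ 1, a step size η ∈ (0,1], and payoff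
vectors r̂¹, …, r̂ᵀ ∈ [0,1]^k, the Hedge iterates are Wᵢ¹ = 1 and
Wᵢ^{t+1} = Wᵢᵗ·exp(η·r̂ᵢᵗ), with Zᵗ = Σᵢ Wᵢᵗ and wᵢᵗ = Wᵢᵗ/Zᵗ.  (Here time is
0-indexed: `W t`, `w t`, `Z t` are the quantities at round t+1, so the times
1 ≤ t ≤ t₂ ≤ T+1 of the statement correspond to indices 0 ≤ t ≤ t₂ ≤ T, and
`r t` is the payoff vector of round t+1 for 0 ≤ t < T.)  Then for any
1 ≤ t ≤ t₂ ≤ T+1, with D_KL(u‖v) = Σᵢ uᵢ·ln(uᵢ/vᵢ),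
D_KL(wᵗ ‖ w^{t₂}) ≤ (η + 2η²)·Σ_{τ=t}^{t₂−1} ⟨r̂^τ, w^τ⟩ − η·Σ_{τ=t}^{t₂−1} ⟨r̂^τ, wᵗ⟩. -/
theorem stmt8 (k T : ℕ) (hk : 1 ≤ k) (hT : 1 ≤ T)
    (η : ℝ) (hη0 : 0 < η) (hη1 : η ≤ 1)
    (r : ℕ → Fin k → ℝ) (hr : ∀ t < T, ∀ i, 0 ≤ r t i ∧ r t i ≤ 1)
    (W : ℕ → Fin k → ℝ) (hW0 : ∀ i, W 0 i = 1)
    (hWrec : ∀ t < T, ∀ i, W (t + 1) i = W t i * Real.exp (η * r t i))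
    (Z : ℕ → ℝ) (hZ : ∀ t, Z t = ∑ i, W t i)
    (w : ℕ → Fin k → ℝ) (hw : ∀ t i, w t i = W t i / Z t)
    (t t₂ : ℕ) (htt₂ : t ≤ t₂) (ht₂T : t₂ ≤ T) :
    ∑ i, w t i * Real.log (w t i / w t₂ i)
      ≤ (η + 2 * η ^ 2) * ∑ τ ∈ Finset.Ico t t₂, ∑ i, r τ i * w τ i
        - η * ∑ τ ∈ Finset.Ico t t₂, ∑ i, r τ i * w t i := by
  have : Nonempty (Fin k) := ⟨⟨0, hk⟩⟩
  have hWpos : ∀ s ≤ T, ∀ i, 0 < W s i := by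
    intro s
    induction s with
    | zero => intro _ i; simp [hW0]
    | succ s ih =>
      intro hs i
      rw [hWrec s hs i]
      exact mul_pos (ih (by omega) i) (Real.exp_pos _)
  have hZpos : ∀ s ≤ T, 0 < Z s := fun s hs => by
    rw [hZ]
    exact Finset.sum_pos (fun i _ => hWpos s hs i) Finset.univ_nonempty
  have hwpos : ∀ s ≤ T, ∀ i, 0 < w s i := fun s hs i => by
    rw [hw]
    exact div_pos (hWpos s hs i) (hZpos s hs)
  have hwsum : ∀ s ≤ T, ∑ i, w s i = 1 := fun s hs => by
    simp_rw [hw, ← Finset.sum_div, ← hZ]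
    exact div_self (hZpos s hs).ne'
  have hlogZ : ∀ n < T, Real.log (Z (n + 1)) - Real.log (Z n)
      ≤ (η + 2 * η ^ 2) * ∑ i, r n i * w n i := by
    intro n hn
    have hZn := hZpos n hn.le
    have hZn1 := hZpos (n + 1) hn
    have hinner : ∑ i, r n i * w n i = (∑ i, r n i * W n i) / Z n := by
      simp_rw [hw, ← mul_div_assoc, Finset.sum_div]
    have hle : Z (n + 1) ≤ Z n + (η + 2 * η ^ 2) * ∑ i, r n i * W n i := by
      rw [hZ, hZ, Finset.mul_sum, ← Finset.sum_add_distrib]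
      refine Finset.sum_le_sum fun i _ => ?_
      rw [hWrec n hn i]
      have h := mul_le_mul_of_nonneg_left
        (Real.exp_mul_le_one_add hη0.le hη1 (hr n hn i).1 (hr n hn i).2) (hWpos n hn.le i).le
      linarith
    rw [← Real.log_div hZn1.ne' hZn.ne']
    refine (Real.log_le_sub_one_of_pos (div_pos hZn1 hZn)).trans ?_
    rw [hinner, ← mul_div_assoc, sub_le_iff_le_add, div_add_one hZn.ne']
    gcongr
    linarith
  induction t₂, htt₂ using Nat.le_induction with
  | base =>
    have h : ∀ i, w t i / w t i = 1 := fun i => div_self (hwpos t ht₂T i).ne'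
    simp [h]
  | succ n htn ih =>
    have hn : n < T := ht₂T
    have ht : t ≤ T := htn.trans hn.le
    have hstep : ∑ i, w t i * Real.log (w t i / w (n + 1) i)
        = ∑ i, w t i * Real.log (w t i / w n i)
          + (Real.log (Z (n + 1)) - Real.log (Z n)) - η * ∑ i, r n i * w t i := by
      have hlog : ∀ i, w t i * Real.log (w t i / w (n + 1) i)
          = w t i * Real.log (w t i / w n i)
            + w t i * (Real.log (Z (n + 1)) - Real.log (Z n)) - η * (r n i * w t i) := by
        intro i
        rw [Real.log_div (hwpos t ht i).ne' (hwpos (n + 1) hn i).ne',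
          Real.log_div (hwpos t ht i).ne' (hwpos n hn.le i).ne', hw (n + 1), hw n,
          Real.log_div (hWpos (n + 1) hn i).ne' (hZpos (n + 1) hn).ne',
          Real.log_div (hWpos n hn.le i).ne' (hZpos n hn.le).ne', hWrec n hn i,
          Real.log_mul (hWpos n hn.le i).ne' (Real.exp_pos _).ne', Real.log_exp]
        ring
      simp_rw [hlog]
      rw [Finset.sum_sub_distrib, Finset.sum_add_distrib, ← Finset.sum_mul, hwsum t ht, one_mul,
        ← Finset.mul_sum]
    rw [hstep, Finset.sum_Ico_succ_top htn, Finset.sum_Ico_succ_top htn]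
    linarith [ih hn.le, hlogZ n hn]
end

section
/- Fix integers k ≥ 1, ϑ ≥ 1 and a real ε with 0 < ε < 1/(2ϑ). Let X be a set containing kϑ distinct points x₁, …, x_{kϑ}, and for i ∈ [k] let Xⁱ = {x_{(i−1)ϑ+1}, …, x_{iϑ}}. Let h₀ : X → {−1,+1}, and for each m ∈ [kϑ] let h_m : X → {−1,+1} satisfy h_m(x_m) ≠ h₀(x_m) and h_m(x_j) = h₀(x_j) for all j ∈ [kϑ] with j ≠ m. For i ∈ [k] and j ∈ [ϑ], let Dⁱⱼ be the distribution on X × {−1,+1} whose X-marginal is uniform on Xⁱ and whose label at each point x is deterministically h_{(i−1)ϑ+j}(x); let Dⁱ₀ be the distribution whose X-marginal is uniform on Xⁱ and whose label at each x is h₀(x). For i ∈ [k], j ∈ [ϑ], define the k-tuple 𝒟ⁱⱼ = (D¹₀, …, D^{i−1}₀, Dⁱⱼ, D^{i+1}₀, …, D^k₀), and for a classifier h : X → {−1,+1} let L_{𝒟}(h) = max_{l ∈ [k]} P_{(x,y)∼𝒟_l}[h(x) ≠ y]. Then for every classifier ĥ : X → {−1,+1} and every pair (i₁, j₁) ≠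 (i₂, j₂) with i₁, i₂ ∈ [k] and j₁, j₂ ∈ [ϑ], the inequalities L_{𝒟^{i₁}_{j₁}}(ĥ) ≤ ε and L_{𝒟^{i₂}_{j₂}}(ĥ) ≤ ε cannot both hold. -/
open Finset

/-!
Labels live in {−1, +1} ⊆ ℤ.  The kϑ distinct points x₁, …, x_{kϑ} are
double-indexed: `x i j` (for `i : Fin k`, `j : Fin ϑ`) is the point
x_{(i−1)ϑ + j} of the group Xⁱ, and distinctness is injectivity of `(i, j) ↦ x i j`.
`h i j` denotes the hypothesis h_{(i−1)ϑ+j}, which disagrees with h₀ exactly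
at the point `x i j`.

The distribution Dⁱ_g with X-marginal uniform on Xⁱ = {x i j : j} and
deterministic labels given by g : X → ℤ yields the error
`L(hhat, Dⁱ_g) = |{j : hhat(x i j) ≠ g(x i j)}| / ϑ`.
The multi-distribution error `L_{𝒟ⁱⱼ}(hhat) ≤ ε` of the instance
𝒟ⁱⱼ = (D¹₀, …, Dⁱⱼ, …, D^k₀) (a max over the k groups being ≤ ε) is therefore
expressed as: for every group l, the error on group l (with labels `h i j` if
l = i and `h₀` otherwise) is ≤ ε.
-/

/-- Two functions on `Fin n` whose normalized Hamming distance is below `1 / (2 * n)` agree. -/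
lemma eq_of_card_filter_ne_div_le {α : Type*} [DecidableEq α] {n : ℕ} (hn : 1 ≤ n) {ε : ℝ}
    (hε : ε < 1 / (2 * n)) {f g : Fin n → α}
    (H : ((univ.filter (fun j => f j ≠ g j)).card : ℝ) / n ≤ ε) (j : Fin n) : f j = g j := by
  by_contra hj
  have hcard : 1 ≤ (univ.filter (fun j => f j ≠ g j)).card :=
    card_pos.mpr ⟨j, by simpa using hj⟩
  have hcard' : (1 : ℝ) ≤ ((univ.filter (fun j => f j ≠ g j)).card : ℝ) := by
    exact_mod_cast hcard
  have hn' : (0 : ℝ) < n := by exact_mod_cast hn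
  have hlt := H.trans_lt hε
  rw [div_lt_div_iff₀ hn' (by positivity)] at hlt
  nlinarith

/-- For every classifier hhat and every pair (i₁, j₁) ≠ (i₂, j₂), the inequalities
L_{𝒟^{i₁}_{j₁}}(hhat) ≤ ε and L_{𝒟^{i₂}_{j₂}}(hhat) ≤ ε cannot both hold, provided
0 < ε < 1/(2ϑ). -/
theorem stmt9 (k ϑ : ℕ) (hk : 1 ≤ k) (hϑ : 1 ≤ ϑ)
    (ε : ℝ) (hε : 0 < ε) (hε2 : ε < 1 / (2 * ϑ))
    {X : Type*} (x : Fin k → Fin ϑ → X)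
    (hxinj : Function.Injective (fun p : Fin k × Fin ϑ => x p.1 p.2))
    (h₀ : X → ℤ) (hh₀ : ∀ z, h₀ z = 1 ∨ h₀ z = -1)
    (h : Fin k → Fin ϑ → X → ℤ)
    (hval : ∀ i j z, h i j z = 1 ∨ h i j z = -1)
    (hflip : ∀ i j, h i j (x i j) ≠ h₀ (x i j))
    (hagree : ∀ i j i' j', (i', j') ≠ (i, j) → h i j (x i' j') = h₀ (x i' j'))
    (hhat : X → ℤ) (hhhat : ∀ z, hhat z = 1 ∨ hhat z = -1)
    (i₁ i₂ : Fin k) (j₁ j₂ : Fin ϑ) (hne : (i₁, j₁) ≠ (i₂, j₂)) :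
    ¬((∀ l : Fin k,
          ((univ.filter (fun j : Fin ϑ =>
              hhat (x l j) ≠ (if l = i₁ then h i₁ j₁ else h₀) (x l j))).card : ℝ) / ϑ
            ≤ ε) ∧
      (∀ l : Fin k,
          ((univ.filter (fun j : Fin ϑ =>
              hhat (x l j) ≠ (if l = i₂ then h i₂ j₂ else h₀) (x l j))).card : ℝ) / ϑ
            ≤ ε)) := by
  rintro ⟨H₁, H₂⟩
  have e₁ := eq_of_card_filter_ne_div_le hϑ hε2 (H₁ i₁) j₁
  have e₂ := eq_of_card_filter_ne_div_le hϑ hε2 (H₂ i₁) j₁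
  rw [if_pos rfl] at e₁
  refine hflip i₁ j₁ (e₁.symm.trans (e₂.trans ?_))
  split_ifs with hi
  · exact hagree i₂ j₂ i₁ j₁ hne
  · rfl
end

section
/- Let D be a probability distribution over X × {−1,+1}, let h* : X → {−1,+1} be a classifier, and let R ⊆ X. Define the 'favorably biased' distribution D̃ over X × {−1,+1} by D̃(S) = D{(x,y) ∈ S : x ∈ R} + D{(x,y) : x ∉ R and (x, h*(x)) ∈ S} for measurable S ⊆ X × {−1,+1}. Then for every classifier h : X → {−1,+1}, P_D[h(x) ≠ y] − P_D[h*(x) ≠ y] ≤ P_{D̃}[h(x) ≠ y] − P_{D̃}[h*(x) ≠ y]. -/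
open MeasureTheory

/-- Favorable bias.  Labels live in {−1, +1}, encoded as `Bool` with
`false ↦ −1`, `true ↦ +1`.  Let D be a probability distribution over
X × {−1,+1}, h* a (measurable) classifier, and R ⊆ X measurable.  Let D̃ be the
"favorably biased" distribution determined by
D̃(S) = D{(x,y) ∈ S : x ∈ R} + D{(x,y) : x ∉ R and (x, h*(x)) ∈ S}
for measurable S.  Then for every measurable classifier h,
P_D[h(x) ≠ y] − P_D[h*(x) ≠ y] ≤ P_{D̃}[h(x) ≠ y] − P_{D̃}[h*(x) ≠ y]. -/
theorem stmt10 {X : Type*} [MeasurableSpace X]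
    (D : Measure (X × Bool)) [IsProbabilityMeasure D]
    (hstar : X → Bool) (hstarMeas : Measurable hstar)
    (R : Set X) (hR : MeasurableSet R)
    (Dt : Measure (X × Bool))
    (hDt : ∀ S : Set (X × Bool), MeasurableSet S →
        Dt S = D {p ∈ S | p.1 ∈ R} + D {p | p.1 ∉ R ∧ (p.1, hstar p.1) ∈ S})
    (h : X → Bool) (hMeas : Measurable h) :
    (D {p | h p.1 ≠ p.2}).toReal - (D {p | hstar p.1 ≠ p.2}).toReal
      ≤ (Dt {p | h p.1 ≠ p.2}).toReal - (Dt {p | hstar p.1 ≠ p.2}).toReal := by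
  have disagreement_meas : ∀ g : X → Bool, Measurable g →
      MeasurableSet {p : X × Bool | g p.1 ≠ p.2} := fun g hg =>
    (measurableSet_eq_fun (hg.comp measurable_fst) measurable_snd).compl
  have hRfst : MeasurableSet {p : X × Bool | p.1 ∈ R} := measurable_fst hR
  have split : ∀ g : X → Bool, D.real {p | g p.1 ≠ p.2} =
      D.real {p | g p.1 ≠ p.2 ∧ p.1 ∈ R} + D.real {p | g p.1 ≠ p.2 ∧ p.1 ∉ R} :=
    fun g => (measureReal_inter_add_sdiff (μ := D) hRfst).symm
  have biased : ∀ g : X → Bool, Measurable g → Dt.real {p | g p.1 ≠ p.2} =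
      D.real {p | g p.1 ≠ p.2 ∧ p.1 ∈ R} + D.real {p | p.1 ∉ R ∧ g p.1 ≠ hstar p.1} := by
    intro g hg
    rw [measureReal_def, hDt _ (disagreement_meas g hg),
      ENNReal.toReal_add (measure_ne_top _ _) (measure_ne_top _ _)]
    rfl
  have triangle : D.real {p | h p.1 ≠ p.2 ∧ p.1 ∉ R} ≤
      D.real {p | hstar p.1 ≠ p.2 ∧ p.1 ∉ R} + D.real {p | p.1 ∉ R ∧ h p.1 ≠ hstar p.1} := by
    refine (measureReal_mono ?_).trans (measureReal_union_le _ _)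
    rintro p ⟨hp, hpR⟩
    by_cases hs : hstar p.1 = p.2
    · exact Or.inr ⟨hpR, fun e => hp (e.trans hs)⟩
    · exact Or.inl ⟨hs, hpR⟩
  have biased_star : D.real {p : X × Bool | p.1 ∉ R ∧ hstar p.1 ≠ hstar p.1} = 0 := by simp
  simp only [← measureReal_def]
  linarith [split h, split hstar, biased h hMeas, biased hstar hstarMeas]
end
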